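/- arXiv:2301.00491 — 3 statements merged into one kernel-verified Lean document; each statement's English description precedes it below -/
import Mathlib

section
/- Let (Q_n)_{n≥0} and (R_n)_{n≥0} be real sequences such that for every a ∈ (0,2) and every k ∈ ℕ the series ∑_{n=0}^∞ exp(−Q_n²/(2a))|Q_n|^k and ∑_{n=0}^∞ exp(−R_n²/(2a))|R_n|^k converge. For k ≥ 1 set c_k = (2π)^{−1/2} ∑_{n=0}^∞ exp(−Q_n²/2) He_{k−1}(Q_n) and d_k = (2π)^{−1/2} ∑_{n=0}^∞ exp(−R_n²/2) He_{k−1}(R_n), and define ℓ(u) = ∑_{k=1}^∞ (c_k d_k / k!) u^k. Then for every u ∈ (−1,1): the series defining ℓ(u) converges absolutely, ℓ is differentiable at u, and ℓ'(u) = (2π √(1−u²))⁻¹ ∑_{n₀=0}^∞ ∑_{n₁=0}^∞ exp(−(Q_{n₀}² + R_{n₁}² − 2u Q_{n₀} R_{n₁})/(2(1−u²))). (Proposition 2.1: explicit derivative of the link function of a latent Gaussian count model.) -/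
open Real

theorem Polynomial.derivative_hermite_succ (n : ℕ) :
    derivative (hermite (n + 1)) = ((n + 1 : ℕ) : Polynomial ℤ) * hermite n := by
  induction n with
  | zero => simp
  | succ n ih =>
    rw [hermite_succ (n + 1), derivative_sub, derivative_mul, derivative_X, ih,
      derivative_mul, derivative_natCast, hermite_succ n]
    push_cast
    ring

theorem Polynomial.aeval_hermite_add_two (n : ℕ) (x : ℝ) :
    aeval x (hermite (n + 2)) =
      x * aeval x (hermite (n + 1)) - (n + 1) * aeval x (hermite n) := by
  rw [hermite_succ (n + 1), derivative_hermite_succ]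
  simp

theorem iteratedDeriv_id_mul_zero {f : ℂ → ℂ} (hf : AnalyticAt ℂ f 0) (n : ℕ) :
    iteratedDeriv n (fun z => z * f z) 0 = n * iteratedDeriv (n - 1) f 0 := by
  rw [iteratedDeriv_fun_mul (f := fun z => z) contDiffAt_id hf.contDiffAt]
  have key (i : ℕ) : iteratedDeriv i (fun z : ℂ => z) 0 = if i = 1 then 1 else 0 := by
    rcases i with _ | _ | i
    · simp
    · simp [iteratedDeriv_succ']
    · simp [iteratedDeriv_succ', iteratedDeriv_const]
  simp only [key]
  rw [Finset.sum_eq_single 1]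
  · simp
  · intro i _ hi
    simp [hi]
  · intro h
    have : n = 0 := by simpa using h
    simp [this]

/-- The holomorphic extension to the unit disc of the Mehler kernel
`(1 - u²)^(-1/2) exp ((2 u x y - u² (x² + y²)) / (2 (1 - u²)))`. -/
noncomputable def mehlerKernel (x y : ℝ) (z : ℂ) : ℂ :=
  Complex.exp (-(1 / 2) * Complex.log (1 - z ^ 2) +
    (2 * x * y * z - (x ^ 2 + y ^ 2) * z ^ 2) / (2 * (1 - z ^ 2)))

theorem one_sub_sq_mem_slitPlane {z : ℂ} (hz : ‖z‖ < 1) : 1 - z ^ 2 ∈ Complex.slitPlane := by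
  rw [sub_eq_add_neg]
  apply Complex.mem_slitPlane_of_norm_lt_one
  rw [norm_neg, norm_pow]
  exact pow_lt_one₀ (norm_nonneg z) hz two_ne_zero

theorem hasDerivAt_mehlerKernel (x y : ℝ) {z : ℂ} (hz : ‖z‖ < 1) :
    HasDerivAt (mehlerKernel x y)
      (mehlerKernel x y z * ((x * y + (1 - (x ^ 2 + y ^ 2)) * z + x * y * z ^ 2 - z ^ 3) /
        (1 - z ^ 2) ^ 2)) z := by
  have hs := one_sub_sq_mem_slitPlane hz
  have h0 : 1 - z ^ 2 ≠ 0 := Complex.slitPlane_ne_zero hs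
  have h1 : HasDerivAt (fun z : ℂ => 1 - z ^ 2) (-(2 * z)) z := by
    simpa using ((hasDerivAt_id z).pow 2).const_sub 1
  have h2 : HasDerivAt (fun z : ℂ => 2 * x * y * z - (x ^ 2 + y ^ 2) * z ^ 2)
      (2 * x * y - (x ^ 2 + y ^ 2) * (2 * z)) z := by
    have h := ((hasDerivAt_id' z).const_mul (2 * x * y : ℂ)).fun_sub
      (((hasDerivAt_id' z).fun_pow 2).const_mul (x ^ 2 + y ^ 2 : ℂ))
    simpa using h
  have h : HasDerivAt (mehlerKernel x y) _ z := (((h1.clog hs).const_mul (-(1 / 2) : ℂ)).fun_add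
    (h2.fun_div (h1.const_mul 2) (mul_ne_zero two_ne_zero h0))).cexp
  refine h.congr_deriv ?_
  rw [mehlerKernel]
  congr 1
  field_simp
  ring

theorem differentiableOn_mehlerKernel (x y : ℝ) :
    DifferentiableOn ℂ (mehlerKernel x y) (Metric.ball 0 1) := fun z hz =>
  (hasDerivAt_mehlerKernel x y (by simpa using hz)).differentiableAt.differentiableWithinAt


theorem mehlerKernel_ode (x y : ℝ) {z : ℂ} (hz : ‖z‖ < 1) :
    deriv (mehlerKernel x y) z + z * (z * (z * (z * deriv (mehlerKernel x y) z)))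
        + (x ^ 2 + y ^ 2 - 1) * (z * mehlerKernel x y z)
        + z * (z * (z * mehlerKernel x y z)) =
      2 * (z * (z * deriv (mehlerKernel x y) z)) + x * y * mehlerKernel x y z
        + x * y * (z * (z * mehlerKernel x y z)) := by
  have h0 : 1 - z ^ 2 ≠ 0 := Complex.slitPlane_ne_zero (one_sub_sq_mem_slitPlane hz)
  rw [(hasDerivAt_mehlerKernel x y hz).deriv]
  field_simp
  ring

theorem iteratedDeriv_mehlerKernel_recurrence (x y : ℝ) (n : ℕ) :
    iteratedDeriv (n + 1) (mehlerKernel x y) 0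
        + n * ((n - 1 : ℕ) * ((n - 1 - 1 : ℕ) * ((n - 1 - 1 - 1 : ℕ) *
          iteratedDeriv (n - 1 - 1 - 1 - 1 + 1) (mehlerKernel x y) 0)))
        + (x ^ 2 + y ^ 2 - 1) * (n * iteratedDeriv (n - 1) (mehlerKernel x y) 0)
        + n * ((n - 1 : ℕ) * ((n - 1 - 1 : ℕ) *
          iteratedDeriv (n - 1 - 1 - 1) (mehlerKernel x y) 0)) =
      2 * (n * ((n - 1 : ℕ) * iteratedDeriv (n - 1 - 1 + 1) (mehlerKernel x y) 0))
        + x * y * iteratedDeriv n (mehlerKernel x y) 0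
        + x * y * (n * ((n - 1 : ℕ) * iteratedDeriv (n - 1 - 1) (mehlerKernel x y) 0)) := by
  have hg : AnalyticAt ℂ (mehlerKernel x y) 0 :=
    (differentiableOn_mehlerKernel x y).analyticAt (Metric.ball_mem_nhds 0 one_pos)
  have hid : AnalyticAt ℂ (fun z : ℂ => z) 0 := analyticAt_id
  have step {f : ℂ → ℂ} (hf : AnalyticAt ℂ f 0) : AnalyticAt ℂ (fun z => z * f z) 0 :=
    hid.fun_mul hf
  have hg1 := step hg
  have hg2 := step hg1
  have hg3 := step hg2
  have hd := hg.deriv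
  have hd1 := step hd
  have hd2 := step hd1
  have hd3 := step hd2
  have hd4 := step hd3
  have hcg1 := (analyticAt_const (v := (x ^ 2 + y ^ 2 - 1 : ℂ))).fun_mul hg1
  have hcg := (analyticAt_const (v := (x * y : ℂ))).fun_mul hg
  have hcg2 := (analyticAt_const (v := (x * y : ℂ))).fun_mul hg2
  have hcd2 := (analyticAt_const (v := (2 : ℂ))).fun_mul hd2
  have hode := Filter.EventuallyEq.iteratedDeriv_eq n
    (Filter.eventually_of_mem (Metric.ball_mem_nhds (0 : ℂ) one_pos)
      fun z hz => mehlerKernel_ode x y (z := z) (by simpa using hz))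
  rw [iteratedDeriv_fun_add ((hd.fun_add hd4).fun_add hcg1).contDiffAt hg3.contDiffAt,
    iteratedDeriv_fun_add (hd.fun_add hd4).contDiffAt hcg1.contDiffAt,
    iteratedDeriv_fun_add hd.contDiffAt hd4.contDiffAt,
    iteratedDeriv_fun_add (hcd2.fun_add hcg).contDiffAt hcg2.contDiffAt,
    iteratedDeriv_fun_add hcd2.contDiffAt hcg.contDiffAt,
    iteratedDeriv_const_mul _ hg1.contDiffAt, iteratedDeriv_const_mul _ hg.contDiffAt,
    iteratedDeriv_const_mul _ hg2.contDiffAt, iteratedDeriv_const_mul _ hd2.contDiffAt,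
    iteratedDeriv_id_mul_zero hd3, iteratedDeriv_id_mul_zero hd2, iteratedDeriv_id_mul_zero hd1,
    iteratedDeriv_id_mul_zero hd1, iteratedDeriv_id_mul_zero hd, iteratedDeriv_id_mul_zero hd,
    iteratedDeriv_id_mul_zero hg2, iteratedDeriv_id_mul_zero hg1, iteratedDeriv_id_mul_zero hg1,
    iteratedDeriv_id_mul_zero hg, iteratedDeriv_id_mul_zero hg, iteratedDeriv_id_mul_zero hg] at hode
  simpa only [iteratedDeriv_succ'] using hode

theorem eq_mul_of_mehler_recurrence {x y : ℂ} {G p q : ℕ → ℂ}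
    (hp0 : p 0 = 1) (hp1 : p 1 = x) (hp : ∀ k : ℕ, p (k + 2) = x * p (k + 1) - (k + 1) * p k)
    (hq0 : q 0 = 1) (hq1 : q 1 = y) (hq : ∀ k : ℕ, q (k + 2) = y * q (k + 1) - (k + 1) * q k)
    (hG0 : G 0 = 1)
    (hG : ∀ n : ℕ, G (n + 1)
        + n * ((n - 1 : ℕ) * ((n - 1 - 1 : ℕ) * ((n - 1 - 1 - 1 : ℕ) * G (n - 1 - 1 - 1 - 1 + 1))))
        + (x ^ 2 + y ^ 2 - 1) * (n * G (n - 1))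
        + n * ((n - 1 : ℕ) * ((n - 1 - 1 : ℕ) * G (n - 1 - 1 - 1))) =
      2 * (n * ((n - 1 : ℕ) * G (n - 1 - 1 + 1))) + x * y * G n
        + x * y * (n * ((n - 1 : ℕ) * G (n - 1 - 1)))) (n : ℕ) :
    G n = p n * q n := by
  induction n using Nat.strong_induction_on with
  | _ n ih =>
    have hrec := hG (n - 1)
    rcases n with _ | _ | _ | _ | _ | n
    · simp [hG0, hp0, hq0]
    · simpa [hG0, hp1, hq1] using hrec
    · simp [ih 0, ih 1, hp0, hp1, hq0, hq1] at hrec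
      simp [hp, hq, hp0, hp1, hq0, hq1]
      linear_combination hrec
    · simp [ih 0, ih 1, ih 2, hp, hq, hp0, hp1, hq0, hq1] at hrec
      simp [hp, hq, hp0, hp1, hq0, hq1]
      linear_combination hrec
    · simp [ih 0, ih 1, ih 2, ih 3, hp, hq, hp0, hp1, hq0, hq1] at hrec
      simp [hp, hq, hp0, hp1, hq0, hq1]
      linear_combination hrec
    · simp [ih (n + 1), ih (n + 2), ih (n + 3), ih (n + 4), hp, hq] at hrec
      simp [hp, hq]
      linear_combination hrec

theorem iteratedDeriv_mehlerKernel (x y : ℝ) (n : ℕ) :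
    iteratedDeriv n (mehlerKernel x y) 0 =
      ((Polynomial.aeval x (Polynomial.hermite n) : ℝ) : ℂ) *
        ((Polynomial.aeval y (Polynomial.hermite n) : ℝ) : ℂ) := by
  refine eq_mul_of_mehler_recurrence (x := x) (y := y)
    (G := fun n => iteratedDeriv n (mehlerKernel x y) 0)
    (p := fun n => ((Polynomial.aeval x (Polynomial.hermite n) : ℝ) : ℂ))
    (q := fun n => ((Polynomial.aeval y (Polynomial.hermite n) : ℝ) : ℂ))
    (by simp) (by simp) (fun k => ?_) (by simp) (by simp) (fun k => ?_) (by simp [mehlerKernel])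
    (iteratedDeriv_mehlerKernel_recurrence x y) n
  all_goals
    rw [Polynomial.aeval_hermite_add_two]
    push_cast
    rfl

theorem hasSum_mehler (x y : ℝ) {u : ℝ} (hu : |u| < 1) :
    HasSum (fun k : ℕ => u ^ k / (k.factorial : ℝ) *
        (Polynomial.aeval x (Polynomial.hermite k) * Polynomial.aeval y (Polynomial.hermite k)))
      ((√(1 - u ^ 2))⁻¹ *
        exp ((2 * u * x * y - u ^ 2 * (x ^ 2 + y ^ 2)) / (2 * (1 - u ^ 2)))) := by
  have h := Complex.hasSum_taylorSeries_on_ball (differentiableOn_mehlerKernel x y)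
    (z := (u : ℂ)) (by simpa using hu)
  have hpos : 0 < 1 - u ^ 2 := by
    have := (sq_lt_one_iff_abs_lt_one u).2 hu
    linarith
  have hsqrt : (√(1 - u ^ 2))⁻¹ = exp (-(1 / 2) * log (1 - u ^ 2)) := by
    rw [sqrt_eq_rpow, ← rpow_neg hpos.le, rpow_def_of_pos hpos, mul_comm]
  have hval : mehlerKernel x y u = (((√(1 - u ^ 2))⁻¹ *
      exp ((2 * u * x * y - u ^ 2 * (x ^ 2 + y ^ 2)) / (2 * (1 - u ^ 2))) : ℝ) : ℂ) := by
    rw [hsqrt, ← exp_add, mehlerKernel]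
    push_cast [Complex.ofReal_log hpos.le]
    congr 2
    ring
  rw [hval] at h
  refine Complex.hasSum_ofReal.1 (h.congr_fun fun k => ?_)
  rw [iteratedDeriv_mehlerKernel]
  push_cast
  simp only [smul_eq_mul, sub_zero]
  ring

/-- The Hermite function `exp (-x² / 2) * He_k x`. -/
noncomputable def hermiteGaussian (k : ℕ) (x : ℝ) : ℝ :=
  exp (-x ^ 2 / 2) * Polynomial.aeval x (Polynomial.hermite k)

theorem hasSum_hermiteGaussian_mul (x y : ℝ) {u : ℝ} (hu : |u| < 1) :
    HasSum (fun k : ℕ => u ^ k / (k.factorial : ℝ) * (hermiteGaussian k x * hermiteGaussian k y))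
      ((√(1 - u ^ 2))⁻¹ * exp (-(x ^ 2 + y ^ 2 - 2 * u * x * y) / (2 * (1 - u ^ 2)))) := by
  have hpos : 1 - u ^ 2 ≠ 0 := by
    have := (sq_lt_one_iff_abs_lt_one u).2 hu
    linarith
  have h := (hasSum_mehler x y hu).mul_left (exp (-x ^ 2 / 2) * exp (-y ^ 2 / 2))
  have hval : (√(1 - u ^ 2))⁻¹ * exp (-(x ^ 2 + y ^ 2 - 2 * u * x * y) / (2 * (1 - u ^ 2))) =
      exp (-x ^ 2 / 2) * exp (-y ^ 2 / 2) * ((√(1 - u ^ 2))⁻¹ *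
        exp ((2 * u * x * y - u ^ 2 * (x ^ 2 + y ^ 2)) / (2 * (1 - u ^ 2)))) := by
    rw [mul_left_comm, ← exp_add, ← exp_add]
    congr 2
    field_simp
    ring
  rw [hval]
  refine h.congr_fun fun k => ?_
  simp only [hermiteGaussian]
  ring

theorem hasSum_hermiteGaussian_sq (x : ℝ) {r : ℝ} (hr0 : 0 ≤ r) (hr : r < 1) :
    HasSum (fun k : ℕ => r ^ k / (k.factorial : ℝ) * hermiteGaussian k x ^ 2)
      ((√(1 - r ^ 2))⁻¹ * exp (-x ^ 2 / (2 * (1 + r))) ^ 2) := by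
  have h := hasSum_hermiteGaussian_mul x x (u := r) (by rwa [abs_of_nonneg hr0])
  have h1 : 1 - r ≠ 0 := by linarith
  have h2 : 1 + r ≠ 0 := by linarith
  have hval : exp (-x ^ 2 / (2 * (1 + r))) ^ 2 =
      exp (-(x ^ 2 + x ^ 2 - 2 * r * x * x) / (2 * (1 - r ^ 2))) := by
    rw [sq, ← exp_add, show 1 - r ^ 2 = (1 - r) * (1 + r) by ring]
    congr 1
    field_simp
    ring
  rw [hval]
  exact h.congr_fun fun k => by rw [sq]

theorem summable_abs_hermiteGaussian_mul (x y : ℝ) {r : ℝ} (hr0 : 0 ≤ r) (hr : r < 1) :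
    Summable (fun k : ℕ =>
        r ^ k / (k.factorial : ℝ) * |hermiteGaussian k x * hermiteGaussian k y|) ∧
      ∑' k : ℕ, r ^ k / (k.factorial : ℝ) * |hermiteGaussian k x * hermiteGaussian k y| ≤
        (√(1 - r ^ 2))⁻¹ *
          (exp (-x ^ 2 / (2 * (1 + r))) * exp (-y ^ 2 / (2 * (1 + r)))) := by
  set a := exp (-x ^ 2 / (2 * (1 + r))) with ha
  set b := exp (-y ^ 2 / (2 * (1 + r))) with hb
  have ha0 : 0 < a := exp_pos _
  have hb0 : 0 < b := exp_pos _
  have hsum := (((hasSum_hermiteGaussian_sq x hr0 hr).mul_left (b / a)).add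
    ((hasSum_hermiteGaussian_sq y hr0 hr).mul_left (a / b))).mul_left (1 / 2)
  rw [← ha, ← hb] at hsum
  have hle (k : ℕ) : r ^ k / (k.factorial : ℝ) * |hermiteGaussian k x * hermiteGaussian k y| ≤
      1 / 2 * (b / a * (r ^ k / (k.factorial : ℝ) * hermiteGaussian k x ^ 2) +
        a / b * (r ^ k / (k.factorial : ℝ) * hermiteGaussian k y ^ 2)) := by
    have hc : 0 ≤ r ^ k / (k.factorial : ℝ) := by positivity
    have key : |hermiteGaussian k x * hermiteGaussian k y| ≤
        1 / 2 * (b / a * hermiteGaussian k x ^ 2 + a / b * hermiteGaussian k y ^ 2) := by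
      have hsq : 1 / 2 * (b / a * hermiteGaussian k x ^ 2 + a / b * hermiteGaussian k y ^ 2) -
          |hermiteGaussian k x * hermiteGaussian k y| =
          (b * |hermiteGaussian k x| - a * |hermiteGaussian k y|) ^ 2 / (2 * a * b) := by
        rw [abs_mul, ← sq_abs (hermiteGaussian k x), ← sq_abs (hermiteGaussian k y)]
        field_simp
        ring
      have : 0 ≤ (b * |hermiteGaussian k x| - a * |hermiteGaussian k y|) ^ 2 / (2 * a * b) := by
        positivity
      linarith
    calc _ ≤ _ := mul_le_mul_of_nonneg_left key hc
      _ = _ := by ring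
  have hs := Summable.of_nonneg_of_le (fun k => by positivity) hle hsum.summable
  refine ⟨hs, (hs.tsum_le_tsum hle hsum.summable).trans_eq ?_⟩
  rw [hsum.tsum_eq]
  field_simp
  ring

theorem summable_prod_hermiteGaussian {Q R : ℕ → ℝ} {r : ℝ} (hr0 : 0 ≤ r) (hr : r < 1)
    (hQ : Summable fun n => exp (-(Q n) ^ 2 / (2 * (1 + r))))
    (hR : Summable fun n => exp (-(R n) ^ 2 / (2 * (1 + r)))) :
    Summable fun z : (ℕ × ℕ) × ℕ => r ^ z.2 / (z.2.factorial : ℝ) *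
      |hermiteGaussian z.2 (Q z.1.1) * hermiteGaussian z.2 (R z.1.2)| := by
  rw [summable_prod_of_nonneg (fun z => by simp only [Pi.zero_apply]; positivity)]
  refine ⟨fun p => (summable_abs_hermiteGaussian_mul (Q p.1) (R p.2) hr0 hr).1, ?_⟩
  refine Summable.of_nonneg_of_le (fun p => tsum_nonneg fun k => by positivity)
    (fun p => (summable_abs_hermiteGaussian_mul (Q p.1) (R p.2) hr0 hr).2) ?_
  exact (hQ.mul_of_nonneg hR (fun n => (exp_pos _).le) (fun n => (exp_pos _).le)).mul_left _

theorem summable_abs_hermiteGaussian {Q : ℕ → ℝ} {r : ℝ} (hr0 : 0 < r) (hr : r < 1)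
    (hQ : Summable fun n => exp (-(Q n) ^ 2 / (2 * (1 + r)))) (k : ℕ) :
    Summable fun n => |hermiteGaussian k (Q n)| := by
  set D : ℝ := (√(1 - r ^ 2))⁻¹ / (r ^ k / (k.factorial : ℝ)) with hD
  refine Summable.of_nonneg_of_le (fun n => abs_nonneg _) (fun n => ?_) (hQ.mul_left (1 + D))
  have hc : 0 < r ^ k / (k.factorial : ℝ) := by positivity
  have hD0 : 0 ≤ D := by positivity
  have h := le_hasSum (hasSum_hermiteGaussian_sq (Q n) hr0.le hr) k fun j _ => by positivity
  have he := exp_pos (-(Q n) ^ 2 / (2 * (1 + r)))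
  set e := exp (-(Q n) ^ 2 / (2 * (1 + r)))
  have h' : hermiteGaussian k (Q n) ^ 2 ≤ D * e ^ 2 := by
    rw [hD, div_mul_eq_mul_div, le_div_iff₀ hc, mul_comm]
    exact h
  refine abs_le_of_sq_le_sq (h'.trans ?_) (by positivity)
  rw [mul_pow]
  have : D ≤ (1 + D) ^ 2 := by nlinarith
  gcongr

theorem hasDerivAt_tsum_div_mul_pow {b : ℕ → ℝ} {r : ℝ}
    (hb : Summable fun k => |b k| * r ^ k) {u : ℝ} (hu : |u| < r) :
    HasDerivAt (fun v => ∑' k : ℕ, b k / (k + 1) * v ^ (k + 1)) (∑' k : ℕ, b k * u ^ k) u := by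
  refine hasDerivAt_tsum_of_isPreconnected (t := Metric.ball 0 r)
    (g := fun k v => b k / (k + 1) * v ^ (k + 1)) (g' := fun k v => b k * v ^ k) (y₀ := 0)
    hb Metric.isOpen_ball (convex_ball 0 r).isPreconnected
    (fun k v _ => ?_) (fun k v hv => ?_) ?_ ?_ ?_
  · have h := (hasDerivAt_pow (k + 1) v).const_mul (b k / (k + 1))
    refine h.congr_deriv ?_
    push_cast
    field_simp
  · rw [norm_mul, norm_pow, Real.norm_eq_abs]
    have : ‖v‖ ≤ r := by simpa using (mem_ball_zero_iff.1 hv).le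
    gcongr
  · exact Metric.mem_ball_self ((abs_nonneg u).trans_lt hu)
  · simp [summable_zero]
  · simpa using hu

theorem stmt0 (Q R : ℕ → ℝ)
    (hQ : ∀ a ∈ Set.Ioo (0:ℝ) 2, ∀ k : ℕ,
      Summable fun n => Real.exp (-(Q n)^2 / (2*a)) * |Q n| ^ k)
    (hR : ∀ a ∈ Set.Ioo (0:ℝ) 2, ∀ k : ℕ,
      Summable fun n => Real.exp (-(R n)^2 / (2*a)) * |R n| ^ k)
    (c d : ℕ → ℝ)
    (hc : ∀ k : ℕ, 1 ≤ k → c k = (Real.sqrt (2*Real.pi))⁻¹ *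
      ∑' n : ℕ, Real.exp (-(Q n)^2 / 2) * Polynomial.aeval (Q n) (Polynomial.hermite (k-1)))
    (hd : ∀ k : ℕ, 1 ≤ k → d k = (Real.sqrt (2*Real.pi))⁻¹ *
      ∑' n : ℕ, Real.exp (-(R n)^2 / 2) * Polynomial.aeval (R n) (Polynomial.hermite (k-1)))
    (ℓ : ℝ → ℝ)
    (hℓ : ∀ u : ℝ, ℓ u = ∑' k : ℕ,
      c (k+1) * d (k+1) / ((k+1).factorial : ℝ) * u^(k+1)) :
    ∀ u ∈ Set.Ioo (-1:ℝ) 1,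
      (Summable fun k : ℕ => |c (k+1) * d (k+1) / ((k+1).factorial : ℝ) * u^(k+1)|) ∧
      HasDerivAt ℓ
        ((2*Real.pi*Real.sqrt (1-u^2))⁻¹ *
          ∑' p : ℕ × ℕ,
            Real.exp (-((Q p.1)^2 + (R p.2)^2 - 2*u*(Q p.1)*(R p.2)) / (2*(1-u^2)))) u := by
  intro u hu
  have hu1 : |u| < 1 := abs_lt.2 hu
  obtain ⟨r, hur, hr1⟩ := exists_between hu1
  have hr0 : 0 < r := (abs_nonneg u).trans_lt hur
  have hQr : Summable fun n => exp (-(Q n) ^ 2 / (2 * (1 + r))) := by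
    simpa using hQ (1 + r) ⟨by linarith, by linarith⟩ 0
  have hRr : Summable fun n => exp (-(R n) ^ 2 / (2 * (1 + r))) := by
    simpa using hR (1 + r) ⟨by linarith, by linarith⟩ 0
  set w : (ℕ × ℕ) → ℕ → ℝ := fun p k => hermiteGaussian k (Q p.1) * hermiteGaussian k (R p.2)
    with hw
  have hjoint : Summable fun z : (ℕ × ℕ) × ℕ => r ^ z.2 / (z.2.factorial : ℝ) * |w z.1 z.2| :=
    summable_prod_hermiteGaussian hr0.le hr1 hQr hRr
  set b : ℕ → ℝ := fun k => c (k + 1) * d (k + 1) / (k.factorial : ℝ) with hb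
  have hcd (k : ℕ) : c (k + 1) * d (k + 1) = (2 * π)⁻¹ * ∑' p : ℕ × ℕ, w p k := by
    have hprod := tsum_mul_tsum_of_summable_norm
      (f := fun n => hermiteGaussian k (Q n)) (g := fun n => hermiteGaussian k (R n))
      (summable_abs_hermiteGaussian hr0 hr1 hQr k)
      (summable_abs_hermiteGaussian hr0 hr1 hRr k)
    rw [hc (k + 1) le_add_self, hd (k + 1) le_add_self, ← hprod]
    have hsqrt : (√(2 * π))⁻¹ * (√(2 * π))⁻¹ = (2 * π)⁻¹ := by
      rw [← mul_inv, mul_self_sqrt (by positivity)]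
    simp only [hermiteGaussian, add_tsub_cancel_right, ← hsqrt]
    ring
  have hbsum : Summable fun k => |b k| * r ^ k := by
    have hswap := (hjoint.prod_symm.prod).mul_left (2 * π)⁻¹
    refine Summable.of_nonneg_of_le (fun k => by positivity) (fun k => ?_) hswap
    have hfib : Summable fun p : ℕ × ℕ => ‖w p k‖ := by
      have h := hjoint.prod_symm.prod_factor k
      have hne : r ^ k / (k.factorial : ℝ) ≠ 0 := by positivity
      simpa [summable_mul_left_iff hne] using h
    have hle : |∑' p : ℕ × ℕ, w p k| ≤ ∑' p : ℕ × ℕ, |w p k| := norm_tsum_le_tsum_norm hfib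
    simp only [hb, hcd, Prod.swap_prod_mk, tsum_mul_left]
    rw [abs_div, abs_mul, abs_of_pos (show 0 < (2 * π)⁻¹ by positivity), Nat.abs_cast]
    calc _ = (2 * π)⁻¹ * (r ^ k / (k.factorial : ℝ) * |∑' p : ℕ × ℕ, w p k|) := by ring
      _ ≤ _ := by gcongr
  have hterm (k : ℕ) (v : ℝ) :
      c (k + 1) * d (k + 1) / ((k + 1).factorial : ℝ) * v ^ (k + 1) =
        b k / (k + 1) * v ^ (k + 1) := by
    simp only [hb, Nat.factorial_succ, Nat.cast_mul, Nat.cast_add, Nat.cast_one]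
    rw [div_div, mul_comm ((k : ℝ) + 1)]
  refine ⟨?_, ?_⟩
  · refine Summable.of_nonneg_of_le (fun k => abs_nonneg _) (fun k => ?_) (hbsum.mul_right r)
    rw [hterm, abs_mul, abs_div, abs_pow, abs_of_pos (show (0 : ℝ) < k + 1 by positivity),
      mul_assoc, ← pow_succ]
    gcongr
    exact div_le_self (abs_nonneg _) (by simp)
  · have hderiv := hasDerivAt_tsum_div_mul_pow hbsum hur
    have hfun : ℓ = fun v => ∑' k : ℕ, b k / (k + 1) * v ^ (k + 1) := by
      ext v
      rw [hℓ]
      exact tsum_congr fun k => hterm k v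
    rw [hfun]
    refine hderiv.congr_deriv ?_
    have hsigned : Summable fun z : (ℕ × ℕ) × ℕ =>
        u ^ z.2 / (z.2.factorial : ℝ) * w z.1 z.2 := by
      refine Summable.of_norm_bounded hjoint fun z => ?_
      rw [norm_mul, norm_div, norm_pow, Real.norm_eq_abs, Real.norm_eq_abs, Real.norm_eq_abs,
        Nat.abs_cast]
      gcongr
    calc ∑' k : ℕ, b k * u ^ k
        = (2 * π)⁻¹ * ∑' k : ℕ, ∑' p : ℕ × ℕ, u ^ k / (k.factorial : ℝ) * w p k := by
          rw [← tsum_mul_left]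
          refine tsum_congr fun k => ?_
          rw [tsum_mul_left]
          simp only [hb, hcd]
          ring
      _ = (2 * π)⁻¹ * ∑' p : ℕ × ℕ, ∑' k : ℕ, u ^ k / (k.factorial : ℝ) * w p k := by
          rw [Summable.tsum_comm
            (f := fun (p : ℕ × ℕ) (k : ℕ) => u ^ k / (k.factorial : ℝ) * w p k) hsigned]
      _ = _ := by
          have hmehler (p : ℕ × ℕ) := (hasSum_hermiteGaussian_mul (Q p.1) (R p.2) hu1).tsum_eq
          simp only [hw, hmehler]
          rw [tsum_mul_left, mul_inv (2 * π), mul_assoc]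
end

section
/- Let A and B be symmetric real d×d matrices with A positive semidefinite. Then sup_{v ∈ K(2s)} |vᵀ(A ⊙ B)v| ≤ (max_{1≤i≤d} A_{ii}) · sup_{v ∈ K(2s)} |vᵀBv|; that is, ‖A ⊙ B‖_s ≤ (max_i A_{ii}) · ‖B‖_s. (Lemma C.1, inequality (C.3).) -/
open Matrix

/-- The sparse quadratic-form "norm" `‖A‖ₛ = sup_{v ∈ K(2s)} |vᵀAv|`, where
`K(2s)` is the set of vectors of Euclidean norm at most one with at most `2s`
nonzero coordinates. -/
noncomputable def sparseSup (d s : ℕ) (A : Matrix (Fin d) (Fin d) ℝ) : ℝ :=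
  sSup {x : ℝ | ∃ v : Fin d → ℝ, (∑ i, v i ^ 2) ≤ 1 ∧
    (Function.support v).ncard ≤ 2 * s ∧ x = |v ⬝ᵥ A.mulVec v|}

lemma dotProduct_mulVec_eq_sum {d : ℕ} (A : Matrix (Fin d) (Fin d) ℝ) (v : Fin d → ℝ) :
    v ⬝ᵥ A.mulVec v = ∑ i, ∑ j, v i * A i j * v j := by
  simp only [dotProduct, mulVec, Finset.mul_sum, mul_assoc]

lemma bddAbove_abs_dotProduct_mulVec_sparse (d s : ℕ) (B : Matrix (Fin d) (Fin d) ℝ) :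
    BddAbove {x : ℝ | ∃ v : Fin d → ℝ, (∑ i, v i ^ 2) ≤ 1 ∧
      (Function.support v).ncard ≤ 2 * s ∧ x = |v ⬝ᵥ B.mulVec v|} := by
  refine ⟨∑ i, ∑ j, |B i j|, ?_⟩
  rintro x ⟨v, hv, -, rfl⟩
  have h1 (i : Fin d) : |v i| ≤ 1 := by
    have := Finset.single_le_sum (f := fun i => v i ^ 2) (fun j _ => sq_nonneg _)
      (Finset.mem_univ i)
    exact abs_le_one_iff_mul_self_le_one.2 (by nlinarith)
  rw [dotProduct_mulVec_eq_sum]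
  refine (Finset.abs_sum_le_sum_abs _ _).trans (Finset.sum_le_sum fun i _ => ?_)
  refine (Finset.abs_sum_le_sum_abs _ _).trans (Finset.sum_le_sum fun j _ => ?_)
  rw [abs_mul, abs_mul]
  have h2 : |v i| * |B i j| ≤ |B i j| := mul_le_of_le_one_left (abs_nonneg _) (h1 i)
  exact (mul_le_of_le_one_right (by positivity) (h1 j)).trans h2

lemma sparseSup_nonneg (d s : ℕ) (B : Matrix (Fin d) (Fin d) ℝ) : 0 ≤ sparseSup d s B := by
  refine Real.sSup_nonneg ?_
  rintro x ⟨v, -, -, rfl⟩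
  exact abs_nonneg _

lemma abs_dotProduct_mulVec_le_sparseSup {d s : ℕ} (B : Matrix (Fin d) (Fin d) ℝ)
    (w : Fin d → ℝ) (hw : (Function.support w).ncard ≤ 2 * s) :
    |w ⬝ᵥ B.mulVec w| ≤ sparseSup d s B * ∑ i, w i ^ 2 := by
  have hN : 0 ≤ ∑ i, w i ^ 2 := Finset.sum_nonneg fun i _ => sq_nonneg _
  rcases hN.eq_or_lt with h0 | hpos
  · have hw0 : w = 0 := by
      funext i
      have := (Finset.sum_eq_zero_iff_of_nonneg (fun i _ => sq_nonneg (w i))).1 h0.symm i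
        (Finset.mem_univ i)
      simpa using this
    simp [hw0]
  · set N := ∑ i, w i ^ 2 with hNdef
    have hr : (√N)⁻¹ ^ 2 = N⁻¹ := by rw [inv_pow, Real.sq_sqrt hN]
    have hmem : |((√N)⁻¹ • w) ⬝ᵥ B.mulVec ((√N)⁻¹ • w)| ≤ sparseSup d s B := by
      refine le_csSup (bddAbove_abs_dotProduct_mulVec_sparse d s B) ⟨(√N)⁻¹ • w, ?_, ?_, rfl⟩
      · simp only [Pi.smul_apply, smul_eq_mul, mul_pow, ← Finset.mul_sum, hr, ← hNdef]
        exact (inv_mul_cancel₀ hpos.ne').le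
      · exact (Set.ncard_le_ncard (Function.support_const_smul_subset _ _)
          (Set.toFinite _)).trans hw
    rw [mulVec_smul, dotProduct_smul, smul_dotProduct, smul_eq_mul, smul_eq_mul, ← mul_assoc,
      ← sq, hr, abs_mul, abs_of_pos (inv_pos.2 hpos), inv_mul_le_iff₀ hpos] at hmem
    linarith

theorem stmt4 (d s : ℕ) (A B : Matrix (Fin d) (Fin d) ℝ)
    (hA : A.IsSymm) (hB : B.IsSymm) (hApsd : A.PosSemidef) :
    sparseSup d s (A.hadamard B) ≤ (⨆ i, A i i) * sparseSup d s B := by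
  have hM : 0 ≤ ⨆ i, A i i := Real.iSup_nonneg fun i => hApsd.diag_nonneg
  have hS := sparseSup_nonneg d s B
  obtain ⟨C, hC⟩ : ∃ C : Matrix (Fin d) (Fin d) ℝ, A = Cᴴ * C := by
    open scoped MatrixOrder in
    exact CStarAlgebra.nonneg_iff_eq_star_mul_self.1 hApsd.nonneg
  have hAC (i j : Fin d) : A i j = ∑ k, C k i * C k j := by
    simp [hC, mul_apply]
  refine Real.sSup_le ?_ (mul_nonneg hM hS)
  rintro x ⟨v, hv, hsupp, rfl⟩
  have hdecomp : v ⬝ᵥ (A.hadamard B).mulVec v =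
      ∑ k, (fun i => C k i * v i) ⬝ᵥ B.mulVec (fun i => C k i * v i) := by
    simp only [dotProduct_mulVec_eq_sum, hadamard_apply, hAC, Finset.sum_mul, Finset.mul_sum]
    conv_rhs => rw [Finset.sum_comm]
    refine Finset.sum_congr rfl fun i _ => ?_
    rw [Finset.sum_comm]
    exact Finset.sum_congr rfl fun k _ => Finset.sum_congr rfl fun j _ => by ring
  have hdiag : ∑ k, ∑ i, (C k i * v i) ^ 2 = ∑ i, A i i * v i ^ 2 := by
    rw [Finset.sum_comm]
    refine Finset.sum_congr rfl fun i _ => ?_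
    rw [hAC, Finset.sum_mul]
    exact Finset.sum_congr rfl fun k _ => by ring
  calc |v ⬝ᵥ (A.hadamard B).mulVec v|
      ≤ ∑ k, |(fun i => C k i * v i) ⬝ᵥ B.mulVec (fun i => C k i * v i)| := by
        rw [hdecomp]
        exact Finset.abs_sum_le_sum_abs _ _
    _ ≤ ∑ k, sparseSup d s B * ∑ i, (C k i * v i) ^ 2 := by
        refine Finset.sum_le_sum fun k _ => abs_dotProduct_mulVec_le_sparseSup B _ ?_
        refine (Set.ncard_le_ncard (fun i hi => ?_) (Set.toFinite _)).trans hsupp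
        exact right_ne_zero_of_mul hi
    _ = sparseSup d s B * ∑ i, A i i * v i ^ 2 := by rw [← Finset.mul_sum, hdiag]
    _ ≤ sparseSup d s B * ∑ i, (⨆ i, A i i) * v i ^ 2 := by
        gcongr with i
        exact le_ciSup (f := fun i => A i i) (Set.finite_range _).bddAbove i
    _ ≤ sparseSup d s B * (⨆ i, A i i) := by
        rw [← Finset.mul_sum]
        exact mul_le_mul_of_nonneg_left (mul_le_of_le_one_right hM hv) hS
    _ = (⨆ i, A i i) * sparseSup d s B := mul_comm _ _
end

section
/- Let M ≥ 1, let p_1, …, p_M > 0 with ∑_{m=1}^M p_m = 1, and let λ_1 > λ_2 > ⋯ > λ_M > 0. Let X have the mixture Poisson distribution P[X = k] = ∑_{m=1}^M p_m e^{−λ_m} λ_m^k / k! for k = 0, 1, 2, …. Then the hazard ratio satisfies P[X = n] / P[X > n] ∼ n/λ_1 as n → ∞; that is, (λ_1 · P[X = n]) / (n · P[X > n]) → 1 as n → ∞. (Asymptotic established in the verification of Assumption 3 for the mixture Poisson distribution, Appendix E.) -/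
open Filter

/-- After normalization by the power of the largest base, a finite sum of exponentials tends to
the coefficient of that base. -/
theorem tendsto_sum_mul_pow_div_pow {ι : Type*} [Fintype ι] (c lam : ι → ℝ) (i : ι)
    (hpos : ∀ m, 0 < lam m) (hlt : ∀ m, m ≠ i → lam m < lam i) :
    Tendsto (fun n : ℕ => (∑ m, c m * lam m ^ n) / lam i ^ n) atTop (nhds (c i)) := by
  classical
  have key : Tendsto (fun n : ℕ => ∑ m, c m * (lam m / lam i) ^ n) atTop
      (nhds (∑ m, if m = i then c m else 0)) := by
    refine tendsto_finsetSum _ fun m _ => ?_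
    by_cases h : m = i
    · subst h
      simp [div_self (hpos m).ne']
    · have h0 := tendsto_pow_atTop_nhds_zero_of_lt_one
        (div_nonneg (hpos m).le (hpos i).le) ((div_lt_one (hpos i)).2 (hlt m h))
      simpa [h] using h0.const_mul (c m)
  simpa [Finset.sum_div, div_pow, mul_div_assoc] using key

/-- If `f (n + 1) ≤ L * f n` and `f (n + 1) / (L * f n) → 1`, then the tail `∑ f k / k!` over `k > n`
is asymptotic to `L / n` times its preceding term `f n / n!`. -/
theorem tendsto_term_div_tail_of_ratio {f : ℕ → ℝ} {L : ℝ} (hL : 0 < L) (hf : ∀ n, 0 < f n)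
    (hle : ∀ n, f (n + 1) ≤ L * f n)
    (hratio : Tendsto (fun n => f (n + 1) / (L * f n)) atTop (nhds 1)) :
    Tendsto (fun n : ℕ => (L * (f n / (n.factorial : ℝ))) /
      ((n : ℝ) * ∑' k : ℕ, f (n + 1 + k) / ((n + 1 + k).factorial : ℝ))) atTop (nhds 1) := by
  have hgrow : ∀ n k, f (n + 1 + k) ≤ L ^ k * (L * f n) := by
    intro n k
    induction k with
    | zero => simpa using hle n
    | succ k ih =>
      calc f (n + 1 + k + 1) ≤ L * f (n + 1 + k) := hle _
        _ ≤ L * (L ^ k * (L * f n)) := by gcongr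
        _ = L ^ (k + 1) * (L * f n) := by ring
  have hfrac : ∀ n k, 0 ≤ f (n + 1 + k) / (L * f n) ∧ f (n + 1 + k) / (L * f n) ≤ L ^ k :=
    fun n k => ⟨(div_pos (hf _) (mul_pos hL (hf n))).le,
      (div_le_iff₀ (mul_pos hL (hf n))).2 (hgrow n k)⟩
  have hfac : ∀ n : ℕ, (n : ℝ) * n.factorial ≤ (n + 1).factorial := by
    intro n
    rw [Nat.factorial_succ]
    push_cast
    gcongr
    linarith
  let g : ℕ → ℕ → ℝ := fun n k =>
    ((n : ℝ) * n.factorial / (n + 1 + k).factorial) * (f (n + 1 + k) / (L * f n))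
  have hg0 : ∀ n k, 0 ≤ g n k := fun n k => mul_nonneg (by positivity) (hfrac n k).1
  have hbound : ∀ n k, g n k ≤ L ^ k / k.factorial := by
    intro n k
    have h1 : (n : ℝ) * n.factorial / (n + 1 + k).factorial ≤ 1 / k.factorial := by
      rw [div_le_div_iff₀ (by positivity) (by positivity), one_mul]
      calc (n : ℝ) * n.factorial * k.factorial ≤ (n + 1).factorial * k.factorial := by
            gcongr
            exact hfac n
        _ ≤ (n + 1 + k).factorial := by
            exact_mod_cast Nat.le_of_dvd (Nat.factorial_pos _)
              (Nat.factorial_mul_factorial_dvd_factorial_add (n + 1) k)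
    calc g n k ≤ 1 / k.factorial * L ^ k :=
          mul_le_mul h1 (hfrac n k).2 (hfrac n k).1 (by positivity)
      _ = L ^ k / k.factorial := by ring
  have hlim : ∀ k, Tendsto (fun n => g n k) atTop (nhds (if k = 0 then 1 else 0)) := by
    rintro (_ | k)
    · have h := tendsto_natCast_div_add_atTop (1 : ℝ) |>.mul hratio
      simp only [mul_one] at h
      simp only [if_true]
      refine h.congr fun n => ?_
      simp only [g, add_zero, Nat.factorial_succ]
      push_cast
      congr 1
      have : (n.factorial : ℝ) ≠ 0 := by positivity
      field_simp
    · have h0 : Tendsto (fun n : ℕ => 1 / ((n : ℝ) + 1) * L ^ (k + 1)) atTop (nhds 0) := by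
        simpa using tendsto_one_div_add_atTop_nhds_zero_nat.mul_const (L ^ (k + 1))
      simp only [Nat.succ_ne_zero, if_false]
      refine squeeze_zero (fun n => hg0 n _) (fun n => ?_) h0
      refine mul_le_mul ?_ (hfrac n _).2 (hfrac n _).1 (by positivity)
      rw [div_le_div_iff₀ (by positivity) (by positivity), one_mul]
      have h2 : ((n + 1 + 1).factorial : ℝ) ≤ (n + 1 + (k + 1)).factorial := by
        exact_mod_cast Nat.factorial_le (by omega)
      rw [Nat.factorial_succ (n + 1)] at h2
      push_cast at h2
      have h3 := hfac n
      nlinarith [Nat.cast_nonneg (α := ℝ) n, Nat.cast_nonneg (α := ℝ) (n + 1).factorial]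
  have hT : Tendsto (fun n => ∑' k, g n k) atTop (nhds 1) := by
    have h := tendsto_tsum_of_dominated_convergence (Real.summable_pow_div_factorial L) hlim
      (Eventually.of_forall fun n k => by
        rw [Real.norm_of_nonneg (hg0 n k)]
        exact hbound n k)
    simpa using h
  have hinv := hT.inv₀ one_ne_zero
  rw [inv_one] at hinv
  refine hinv.congr fun n => ?_
  have hfn := (hf n).ne'
  have hn : (n.factorial : ℝ) ≠ 0 := by positivity
  have hsum : ∑' k, g n k = (n : ℝ) * (∑' k : ℕ, f (n + 1 + k) / ((n + 1 + k).factorial : ℝ)) /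
      (L * (f n / n.factorial)) := by
    rw [mul_div_right_comm, ← tsum_mul_left]
    refine tsum_congr fun k => ?_
    simp only [g]
    field_simp
  rw [hsum, inv_div]

theorem stmt18 (M : ℕ) (hM : 0 < M) (p lam : Fin M → ℝ)
    (hp : ∀ m, 0 < p m) (hsum : ∑ m, p m = 1)
    (hanti : StrictAnti lam) (hpos : ∀ m, 0 < lam m) :
    Tendsto (fun n : ℕ =>
        (lam ⟨0, hM⟩ *
          (∑ m, p m * Real.exp (-(lam m)) * (lam m)^n / (n.factorial : ℝ))) /
        ((n : ℝ) *
          ∑' k : ℕ, ∑ m, p m * Real.exp (-(lam m)) * (lam m)^(n+1+k)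
            / ((n+1+k).factorial : ℝ)))
      atTop (nhds 1) := by
  have hc : ∀ m, 0 < p m * Real.exp (-(lam m)) := fun m => mul_pos (hp m) (Real.exp_pos _)
  have hL := hpos ⟨0, hM⟩
  have hlim := tendsto_sum_mul_pow_div_pow (fun m => p m * Real.exp (-(lam m))) lam ⟨0, hM⟩ hpos
    fun m hm => hanti (lt_of_le_of_ne (Fin.mk_le_of_le_val (Nat.zero_le _)) hm.symm)
  have hf : ∀ n : ℕ, 0 < ∑ m, p m * Real.exp (-(lam m)) * lam m ^ n := fun n =>
    Finset.sum_pos (fun m _ => mul_pos (hc m) (pow_pos (hpos m) n)) ⟨⟨0, hM⟩, Finset.mem_univ _⟩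
  have hle : ∀ n : ℕ, ∑ m, p m * Real.exp (-(lam m)) * lam m ^ (n + 1) ≤
      lam ⟨0, hM⟩ * ∑ m, p m * Real.exp (-(lam m)) * lam m ^ n := by
    intro n
    rw [Finset.mul_sum]
    refine Finset.sum_le_sum fun m _ => ?_
    have hm : lam m ≤ lam ⟨0, hM⟩ := hanti.antitone (Fin.mk_le_of_le_val (Nat.zero_le _))
    calc p m * Real.exp (-(lam m)) * lam m ^ (n + 1)
        = lam m * (p m * Real.exp (-(lam m)) * lam m ^ n) := by ring
      _ ≤ lam ⟨0, hM⟩ * (p m * Real.exp (-(lam m)) * lam m ^ n) :=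
        mul_le_mul_of_nonneg_right hm (mul_pos (hc m) (pow_pos (hpos m) n)).le
  have hratio := (hlim.comp (tendsto_add_atTop_nat 1)).div hlim (hc _).ne'
  rw [div_self (hc _).ne'] at hratio
  have h := tendsto_term_div_tail_of_ratio hL hf hle <| hratio.congr fun n => by
    have := (hf n).ne'
    simp only [Pi.div_apply, Function.comp_apply]
    field_simp
    ring
  simpa only [Finset.sum_div] using h
end
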